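/- arXiv:1805.07168 — 2 statements merged into one kernel-verified Lean document; each statement's English description precedes it below -/
import Mathlib

section
/- There exists a constant C > 0 such that for all integers n ≥ 1, |S_n − (1/2)·log₂(π n / 2)| ≤ C, where S_n = −Σ_{j=−n}^{n} p_j · log₂ p_j and p_j = binomial(2n, n−j)² / binomial(4n, 2n) for j ∈ {−n, …, n}. That is, the half-chain entanglement entropy of the uniform superposition of fully reducible words in the d = 2 pair-flip model on a chain of length 4n equals (1/2)·log₂ n + O(1) bits. -/
/-- `pcoef n j = binomial(2n, n−j)² / binomial(4n, 2n)` for `j ∈ {−n, …, n}`: the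
squared Schmidt coefficients across the middle cut of the uniform superposition of
fully reducible words of length `4n` in the `d = 2` pair-flip model. -/
noncomputable def pcoef (n : ℕ) (j : ℤ) : ℝ :=
  ((Nat.choose (2 * n) (((n : ℤ) - j).toNat) : ℝ)) ^ 2 /
    (Nat.choose (4 * n) (2 * n) : ℝ)

/-- `Sent n = −Σ_{j=−n}^{n} p_j · log₂ p_j`: the half-chain entanglement entropy, in
bits, of the uniform superposition of fully reducible words of length `4n` in the
`d = 2` pair-flip model. -/
noncomputable def Sent (n : ℕ) : ℝ :=
  - ∑ j ∈ Finset.Icc (-(n : ℤ)) (n : ℤ), pcoef n j * Real.logb 2 (pcoef n j)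

/-! ### Reindexing and moments -/

lemma sum_reindex (n : ℕ) (G : ℕ → ℝ) :
    ∑ j ∈ Finset.Icc (-(n : ℤ)) (n : ℤ), G (((n : ℤ) - j).toNat)
      = ∑ k ∈ Finset.range (2 * n + 1), G k := by
  refine Finset.sum_nbij' (fun j => ((n : ℤ) - j).toNat) (fun k => (n : ℤ) - (k : ℤ)) ?_ ?_ ?_ ?_ ?_
  · intro j hj
    simp only [Finset.mem_Icc, Finset.mem_range] at *
    omega
  · intro j hj
    simp only [Finset.mem_Icc, Finset.mem_range] at *
    omega
  · intro j hj
    simp only [Finset.mem_Icc] at *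
    omega
  · intro j hj
    simp only [Finset.mem_range] at *
    omega
  · intro j hj
    rfl

lemma sum_sq (N : ℕ) :
    ∑ k ∈ Finset.range (N + 1), ((N.choose k : ℝ)) ^ 2 = (N.centralBinom : ℝ) := by
  have h := Nat.sum_range_choose_sq N
  rw [Nat.centralBinom_eq_two_mul_choose, ← h]
  push_cast
  rfl

lemma sum_first (N : ℕ) :
    2 * ∑ k ∈ Finset.range (N + 1), (k : ℝ) * ((N.choose k : ℝ)) ^ 2
      = N * (N.centralBinom : ℝ) := by
  have h := Finset.sum_range_reflect (fun k => (k : ℝ) * ((N.choose k : ℝ)) ^ 2) (N + 1)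
  have h2 : ∑ k ∈ Finset.range (N + 1), ((N : ℝ) - k) * ((N.choose k : ℝ)) ^ 2
      = ∑ k ∈ Finset.range (N + 1), (k : ℝ) * ((N.choose k : ℝ)) ^ 2 := by
    rw [← h]
    refine Finset.sum_congr rfl fun k hk => ?_
    have hk' : k ≤ N := by simpa [Nat.lt_succ_iff] using hk
    have e : N + 1 - 1 - k = N - k := by omega
    simp only [e]
    rw [Nat.choose_symm hk', Nat.cast_sub hk']
  simp only [sub_mul, Finset.sum_sub_distrib, ← Finset.mul_sum, sum_sq] at h2
  linarith

lemma sum_second (m : ℕ) :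
    ∑ k ∈ Finset.range (m + 1 + 1), (k : ℝ) ^ 2 * (((m + 1).choose k : ℝ)) ^ 2
      = ((m : ℝ) + 1) ^ 2 * (m.centralBinom : ℝ) := by
  rw [Finset.sum_range_succ', ← sum_sq, Finset.mul_sum]
  simp only [Nat.cast_zero, ne_eq, OfNat.ofNat_ne_zero, not_false_eq_true, zero_pow, zero_mul,
    add_zero]
  refine Finset.sum_congr rfl fun k _ => ?_
  have h : ((m : ℝ) + 1) * (m.choose k : ℝ) = ((m + 1).choose (k + 1) : ℝ) * ((k : ℝ) + 1) := by
    exact_mod_cast Nat.add_one_mul_choose_eq m k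
  rw [← mul_pow, ← mul_pow, h]
  push_cast
  ring

lemma variance_bound (n : ℕ) (hn : 1 ≤ n) :
    ∑ k ∈ Finset.range (2 * n + 1), ((n : ℝ) - k) ^ 2 * (((2 * n).choose k : ℝ)) ^ 2
      ≤ n * ((2 * n).centralBinom : ℝ) := by
  obtain ⟨m, hm⟩ : ∃ m, 2 * n = m + 1 := ⟨2 * n - 1, by omega⟩
  have h0 := sum_sq (2 * n)
  have h1 := sum_first (2 * n)
  have h2 := sum_second m
  have h3 : ((m : ℝ) + 1) * ((m + 1).centralBinom : ℝ)
      = 2 * (2 * m + 1) * (m.centralBinom : ℝ) := by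
    exact_mod_cast Nat.succ_mul_centralBinom_succ m
  rw [← hm] at h2 h3
  have hm' : (m : ℝ) = 2 * n - 1 := by
    have : ((2 * n : ℕ) : ℝ) = ((m + 1 : ℕ) : ℝ) := by rw [hm]
    push_cast at this
    linarith
  rw [hm'] at h2 h3
  have hx : (1 : ℝ) ≤ n := by exact_mod_cast hn
  have hsplit : ∑ k ∈ Finset.range (2 * n + 1), ((n : ℝ) - k) ^ 2 * (((2 * n).choose k : ℝ)) ^ 2
      = n ^ 2 * ∑ k ∈ Finset.range (2 * n + 1), (((2 * n).choose k : ℝ)) ^ 2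
        - n * (2 * ∑ k ∈ Finset.range (2 * n + 1), (k : ℝ) * (((2 * n).choose k : ℝ)) ^ 2)
        + ∑ k ∈ Finset.range (2 * n + 1), (k : ℝ) ^ 2 * (((2 * n).choose k : ℝ)) ^ 2 := by
    simp only [Finset.mul_sum, ← Finset.sum_sub_distrib, ← Finset.sum_add_distrib]
    refine Finset.sum_congr rfl fun k _ => ?_
    ring
  rw [hsplit, h0, h1, h2]
  have hc : (0 : ℝ) ≤ (m.centralBinom : ℝ) := by positivity
  have hB : ((2 * n).centralBinom : ℝ) = (4 * n - 1) / n * (m.centralBinom : ℝ) := by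
    field_simp
    linarith
  rw [hB]
  push_cast
  have key : (n : ℝ) * ((4 * n - 1) / n * (m.centralBinom : ℝ))
      - (n ^ 2 * ((4 * n - 1) / n * (m.centralBinom : ℝ))
        - n * (2 * n * ((4 * n - 1) / n * (m.centralBinom : ℝ)))
        + (2 * n - 1 + 1) ^ 2 * (m.centralBinom : ℝ))
      = (3 * n - 1) * (m.centralBinom : ℝ) := by
    field_simp
    ring
  have : 0 ≤ (3 * (n : ℝ) - 1) * (m.centralBinom : ℝ) := mul_nonneg (by linarith) hc
  linarith

/-! ### Central binomial bounds -/

lemma cb_upper (n : ℕ) : (n.centralBinom : ℝ) ^ 2 * (2 * n + 1) ≤ 16 ^ n := by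
  induction n with
  | zero => simp
  | succ k ih =>
    have h3 : ((k : ℝ) + 1) * ((k + 1).centralBinom : ℝ)
        = 2 * (2 * k + 1) * (k.centralBinom : ℝ) := by
      exact_mod_cast Nat.succ_mul_centralBinom_succ k
    have hB : ((k + 1).centralBinom : ℝ) = 2 * (2 * k + 1) / (k + 1) * (k.centralBinom : ℝ) := by
      field_simp
      linarith
    rw [hB, pow_succ (16 : ℝ)]
    push_cast
    have : (2 * (2 * (k : ℝ) + 1) / (k + 1) * (k.centralBinom : ℝ)) ^ 2 * (2 * (k + 1) + 1)
        = ((k.centralBinom : ℝ) ^ 2 * (2 * k + 1)) *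
          (4 * (2 * k + 1) * (2 * k + 3) / (k + 1) ^ 2) := by
      field_simp
      ring
    rw [this]
    refine mul_le_mul ih ?_ (by positivity) (by positivity)
    rw [div_le_iff₀ (by positivity)]
    nlinarith

lemma cb_lower (n : ℕ) (hn : 1 ≤ n) : 16 ^ n ≤ (n.centralBinom : ℝ) ^ 2 * (4 * n) := by
  induction n, hn using Nat.le_induction with
  | base => norm_num [Nat.centralBinom]
  | succ k hk ih =>
    have h3 : ((k : ℝ) + 1) * ((k + 1).centralBinom : ℝ)
        = 2 * (2 * k + 1) * (k.centralBinom : ℝ) := by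
      exact_mod_cast Nat.succ_mul_centralBinom_succ k
    have hB : ((k + 1).centralBinom : ℝ) = 2 * (2 * k + 1) / (k + 1) * (k.centralBinom : ℝ) := by
      field_simp
      linarith
    have hk0 : (0 : ℝ) < k := by exact_mod_cast hk
    rw [hB, pow_succ (16 : ℝ)]
    push_cast
    have : (2 * (2 * (k : ℝ) + 1) / (k + 1) * (k.centralBinom : ℝ)) ^ 2 * (4 * (k + 1))
        = ((k.centralBinom : ℝ) ^ 2 * (4 * k)) *
          (4 * (2 * k + 1) ^ 2 / (k * (k + 1))) := by
      field_simp
      ring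
    rw [this]
    refine mul_le_mul ih ?_ (by positivity) (by positivity)
    rw [le_div_iff₀ (by positivity)]
    nlinarith

lemma pcoef_eq (n : ℕ) (j : ℤ) :
    pcoef n j = (((2 * n).choose (((n : ℤ) - j).toNat) : ℝ)) ^ 2 / ((2 * n).centralBinom : ℝ) := by
  unfold pcoef
  rw [Nat.centralBinom_eq_two_mul_choose, ← mul_assoc]
  norm_num

lemma cb_pos (n : ℕ) : (0 : ℝ) < (n.centralBinom : ℝ) := by
  exact_mod_cast Nat.centralBinom_pos n

lemma pcoef_le (n : ℕ) (hn : 1 ≤ n) (j : ℤ) : pcoef n j ≤ 2 / Real.sqrt n := by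
  have hx : (1 : ℝ) ≤ n := by exact_mod_cast hn
  have hs : 0 < Real.sqrt n := Real.sqrt_pos.mpr (by linarith)
  have hss : Real.sqrt n ^ 2 = n := Real.sq_sqrt (by linarith)
  rw [pcoef_eq, div_le_div_iff₀ (cb_pos _) hs]
  have h1 : (((2 * n).choose (((n : ℤ) - j).toNat) : ℝ)) ≤ (n.centralBinom : ℝ) := by
    exact_mod_cast Nat.choose_le_centralBinom _ n
  have h2 : (((2 * n).choose (((n : ℤ) - j).toNat) : ℝ)) ^ 2 ≤ (n.centralBinom : ℝ) ^ 2 := by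
    gcongr
  have hu := cb_upper n
  have hl := cb_lower (2 * n) (by omega)
  refine le_trans (mul_le_mul_of_nonneg_right h2 hs.le) ?_
  refine le_of_sq_le_sq ?_ (by positivity)
  have h4 : ((n.centralBinom : ℝ) ^ 2 * (2 * n)) ^ 2 ≤ (16 ^ n) ^ 2 := by
    refine pow_le_pow_left₀ (by positivity) ?_ 2
    nlinarith [sq_nonneg (n.centralBinom : ℝ)]
  rw [← pow_mul, mul_comm n 2] at h4
  have h5 := h4.trans hl
  push_cast at h5
  rw [mul_pow, hss]
  have hx0 : (0 : ℝ) < 4 * n := by linarith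
  refine le_of_mul_le_mul_left ?_ hx0
  nlinarith [h5]

lemma pcoef_pos (n : ℕ) (j : ℤ) (hj : j ∈ Finset.Icc (-(n : ℤ)) (n : ℤ)) : 0 < pcoef n j := by
  rw [pcoef_eq]
  have : 0 < (2 * n).choose (((n : ℤ) - j).toNat) := by
    apply Nat.choose_pos
    simp only [Finset.mem_Icc] at hj
    omega
  have h : (0 : ℝ) < ((2 * n).choose (((n : ℤ) - j).toNat) : ℝ) := by exact_mod_cast this
  have := cb_pos (2 * n)
  positivity

lemma pcoef_sum (n : ℕ) : ∑ j ∈ Finset.Icc (-(n : ℤ)) (n : ℤ), pcoef n j = 1 := by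
  simp only [pcoef_eq]
  rw [sum_reindex n (fun k => (((2 * n).choose k : ℝ)) ^ 2 / ((2 * n).centralBinom : ℝ)),
    ← Finset.sum_div, sum_sq, div_self (cb_pos _).ne']

lemma pcoef_var (n : ℕ) (hn : 1 ≤ n) :
    ∑ j ∈ Finset.Icc (-(n : ℤ)) (n : ℤ), pcoef n j * (j : ℝ) ^ 2 ≤ n := by
  have h : ∑ j ∈ Finset.Icc (-(n : ℤ)) (n : ℤ), pcoef n j * (j : ℝ) ^ 2
      = ∑ j ∈ Finset.Icc (-(n : ℤ)) (n : ℤ),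
        (fun k : ℕ => ((n : ℝ) - k) ^ 2 * (((2 * n).choose k : ℝ)) ^ 2
          / ((2 * n).centralBinom : ℝ)) (((n : ℤ) - j).toNat) := by
    refine Finset.sum_congr rfl fun j hj => ?_
    simp only [Finset.mem_Icc] at hj
    have e : ((((n : ℤ) - j).toNat : ℕ) : ℝ) = (n : ℝ) - j := by
      have : ((((n : ℤ) - j).toNat : ℕ) : ℤ) = (n : ℤ) - j := Int.toNat_of_nonneg (by omega)
      exact_mod_cast congrArg (Int.cast : ℤ → ℝ) this
    simp only [pcoef_eq, e]
    ring
  rw [h, sum_reindex n (fun k : ℕ => ((n : ℝ) - k) ^ 2 * (((2 * n).choose k : ℝ)) ^ 2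
          / ((2 * n).centralBinom : ℝ)), ← Finset.sum_div, div_le_iff₀ (cb_pos _)]
  exact variance_bound n hn

/-! ### The comparison weights -/

lemma weight_sum (s : ℝ) (hs : 1 ≤ s) (m : ℕ) :
    ∑ j ∈ Finset.Icc (-(m : ℤ)) (m : ℤ), s ^ 2 / (s + |(j : ℝ)|) ^ 2
      ≤ 1 + 2 * s ^ 2 * (1 / s - 1 / (s + m)) := by
  have hs0 : 0 < s := by linarith
  induction m with
  | zero => simp [hs0.ne']
  | succ k ih =>
    have hI : Finset.Icc (-((k + 1 : ℕ) : ℤ)) ((k + 1 : ℕ) : ℤ)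
        = insert (-((k : ℤ) + 1)) (insert ((k : ℤ) + 1) (Finset.Icc (-(k : ℤ)) (k : ℤ))) := by
      ext x
      simp only [Finset.mem_Icc, Finset.mem_insert]
      push_cast
      omega
    rw [hI, Finset.sum_insert (by simp only [Finset.mem_insert, Finset.mem_Icc]; omega),
      Finset.sum_insert (by simp only [Finset.mem_Icc]; omega)]
    push_cast
    have hk : (0 : ℝ) ≤ k := by positivity
    rw [abs_neg, abs_of_nonneg (by linarith : (0 : ℝ) ≤ (k : ℝ) + 1)]
    have hd : s ^ 2 / (s + (k + 1)) ^ 2 ≤ s ^ 2 * (1 / (s + k) - 1 / (s + (k + 1))) := by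
      rw [div_eq_mul_inv]
      refine mul_le_mul_of_nonneg_left ?_ (by positivity)
      have : 1 / (s + k) - 1 / (s + (k + 1)) = 1 / ((s + k) * (s + (k + 1))) := by
        field_simp
        ring
      rw [this, ← one_div]
      apply one_div_le_one_div_of_le (by positivity)
      nlinarith
    linarith

lemma weight_sum' (s : ℝ) (hs : 1 ≤ s) (m : ℕ) :
    ∑ j ∈ Finset.Icc (-(m : ℤ)) (m : ℤ), s / (s + |(j : ℝ)|) ^ 2 ≤ 3 := by
  have hs0 : 0 < s := by linarith
  have h := weight_sum s hs m
  have h2 : ∑ j ∈ Finset.Icc (-(m : ℤ)) (m : ℤ), s ^ 2 / (s + |(j : ℝ)|) ^ 2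
      = s * ∑ j ∈ Finset.Icc (-(m : ℤ)) (m : ℤ), s / (s + |(j : ℝ)|) ^ 2 := by
    rw [Finset.mul_sum]
    refine Finset.sum_congr rfl fun j _ => ?_
    ring
  have h3 : 2 * s ^ 2 * (1 / s - 1 / (s + m)) ≤ 2 * s := by
    have : 0 ≤ 2 * s ^ 2 * (1 / (s + m)) := by positivity
    have e : 2 * s ^ 2 * (1 / s) = 2 * s := by field_simp
    rw [mul_sub]
    linarith
  rw [h2] at h
  refine le_of_mul_le_mul_left ?_ hs0
  linarith

/-! ### Entropy bounds in nats -/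

lemma nats_lower (n : ℕ) (hn : 1 ≤ n) :
    Real.log n / 2 - Real.log 2 ≤
      - ∑ j ∈ Finset.Icc (-(n : ℤ)) (n : ℤ), pcoef n j * Real.log (pcoef n j) := by
  have hx : (1 : ℝ) ≤ n := by exact_mod_cast hn
  have hs : 0 < Real.sqrt n := Real.sqrt_pos.mpr (by linarith)
  have h : ∑ j ∈ Finset.Icc (-(n : ℤ)) (n : ℤ), pcoef n j * Real.log (pcoef n j)
      ≤ ∑ j ∈ Finset.Icc (-(n : ℤ)) (n : ℤ), pcoef n j * (Real.log 2 - Real.log n / 2) := by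
    refine Finset.sum_le_sum fun j hj => ?_
    have hp := pcoef_pos n j hj
    refine mul_le_mul_of_nonneg_left ?_ hp.le
    rw [← Real.log_sqrt (by linarith), ← Real.log_div (by norm_num) hs.ne']
    exact Real.log_le_log hp (pcoef_le n hn j)
  rw [← Finset.sum_mul, pcoef_sum] at h
  linarith

lemma nats_upper (n : ℕ) (hn : 1 ≤ n) :
    - ∑ j ∈ Finset.Icc (-(n : ℤ)) (n : ℤ), pcoef n j * Real.log (pcoef n j)
      ≤ Real.log n / 2 + 4 := by
  have hx : (1 : ℝ) ≤ n := by exact_mod_cast hn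
  have hs1 : 1 ≤ Real.sqrt n := Real.one_le_sqrt.mpr hx
  have hss : Real.sqrt n ^ 2 = n := Real.sq_sqrt (by linarith)
  have hls : Real.log (Real.sqrt n) = Real.log n / 2 := Real.log_sqrt (by linarith)
  set s := Real.sqrt n with hsdef
  have hs : 0 < s := by linarith
  have hW := weight_sum' s hs1 n
  have hV := pcoef_var n hn
  have hterm : ∀ j ∈ Finset.Icc (-(n : ℤ)) (n : ℤ),
      -(pcoef n j * Real.log (pcoef n j)) ≤
        pcoef n j * (Real.log n / 2) + pcoef n j * (j : ℝ) ^ 2 * (1 / n)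
          + s / (s + |(j : ℝ)|) ^ 2 := by
    intro j hj
    have hp := pcoef_pos n j hj
    have ha : 0 ≤ |(j : ℝ)| := abs_nonneg _
    set q := s / (s + |(j : ℝ)|) ^ 2 with hq
    have hq0 : 0 < q := by positivity
    have h1 : Real.log (q / pcoef n j) ≤ q / pcoef n j - 1 :=
      Real.log_le_sub_one_of_pos (by positivity)
    rw [Real.log_div hq0.ne' hp.ne'] at h1
    have h2 := mul_le_mul_of_nonneg_left h1 hp.le
    have e : pcoef n j * (q / pcoef n j - 1) = q - pcoef n j := by
      field_simp
    rw [e] at h2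
    have h3 : -Real.log q ≤ Real.log n / 2 + (j : ℝ) ^ 2 * (1 / n) + 1 := by
      have e1 : s + |(j : ℝ)| = s * (1 + |(j : ℝ)| / s) := by field_simp
      have h4 : Real.log (1 + |(j : ℝ)| / s) ≤ |(j : ℝ)| / s := by
        have := Real.log_le_sub_one_of_pos (by positivity : 0 < 1 + |(j : ℝ)| / s)
        linarith
      have h5 : Real.log q = Real.log s - 2 * (Real.log s + Real.log (1 + |(j : ℝ)| / s)) := by
        rw [hq, Real.log_div hs.ne' (by positivity), Real.log_pow, e1,
          Real.log_mul hs.ne' (by positivity)]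
        push_cast
        ring
      have h6 : (j : ℝ) ^ 2 * (1 / n) = (|(j : ℝ)| / s) ^ 2 := by
        rw [div_pow, sq_abs, hss]
        ring
      rw [h5, h6, ← hls]
      nlinarith [sq_nonneg (|(j : ℝ)| / s - 1)]
    have h7 := mul_le_mul_of_nonneg_left h3 hp.le
    nlinarith
  rw [← Finset.sum_neg_distrib]
  refine (Finset.sum_le_sum hterm).trans ?_
  rw [Finset.sum_add_distrib, Finset.sum_add_distrib, ← Finset.sum_mul, ← Finset.sum_mul,
    pcoef_sum]
  have h8 : (∑ j ∈ Finset.Icc (-(n : ℤ)) (n : ℤ), pcoef n j * (j : ℝ) ^ 2) * (1 / n) ≤ 1 := by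
    rw [mul_one_div, div_le_one (by linarith)]
    exact hV
  linarith

/-- there is a constant `C > 0` with
`|S_n − (1/2)·log₂(π n / 2)| ≤ C` for all `n ≥ 1`; that is, the half-chain entropy
equals `(1/2)·log₂ n + O(1)` bits. -/
theorem pf2_entropy_scaling :
    ∃ C : ℝ, 0 < C ∧ ∀ n : ℕ, 1 ≤ n →
      |Sent n - (1 / 2) * Real.logb 2 (Real.pi * (n : ℝ) / 2)| ≤ C := by
  have hl2 : 0 < Real.log 2 := Real.log_pos (by norm_num)
  have hl2' : Real.log 2 ≤ 1 := by
    have := Real.log_le_sub_one_of_pos (by norm_num : (0 : ℝ) < 2)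
    linarith
  refine ⟨5 / Real.log 2, by positivity, fun n hn => ?_⟩
  have hx : (1 : ℝ) ≤ n := by exact_mod_cast hn
  have hS : Sent n = (- ∑ j ∈ Finset.Icc (-(n : ℤ)) (n : ℤ),
      pcoef n j * Real.log (pcoef n j)) / Real.log 2 := by
    unfold Sent Real.logb
    rw [neg_div, Finset.sum_div]
    simp only [mul_div_assoc]
  have hlo := nats_lower n hn
  have hup := nats_upper n hn
  have hpi0 : 0 ≤ Real.log (Real.pi / 2) := Real.log_nonneg (by linarith [Real.pi_gt_three])
  have hpi1 : Real.log (Real.pi / 2) ≤ 1 := by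
    have := Real.log_le_sub_one_of_pos (by positivity : (0 : ℝ) < Real.pi / 2)
    linarith [Real.pi_le_four]
  have hlog : Real.log (Real.pi * (n : ℝ) / 2) = Real.log (Real.pi / 2) + Real.log n := by
    rw [← Real.log_mul (by positivity) (by positivity)]
    congr 1
    ring
  have e : Sent n - (1 / 2) * Real.logb 2 (Real.pi * (n : ℝ) / 2)
      = ((- ∑ j ∈ Finset.Icc (-(n : ℤ)) (n : ℤ), pcoef n j * Real.log (pcoef n j))
        - (Real.log (Real.pi / 2) + Real.log n) / 2) / Real.log 2 := by
    rw [hS, Real.logb, hlog]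
    ring
  rw [e, abs_div, abs_of_pos hl2]
  refine div_le_div_of_nonneg_right ?_ hl2.le
  rw [abs_le]
  constructor <;> linarith
end

section
/- For every integer d ≥ 2 and every n ≥ 1, W_{2n}^{(d)} = (W_n^{(d)})² + Σ_{k=1}^{n} d(d−1)^{2k−1} · (W_{n−k, 2k}^{(d)})², where W_m^{(d)} is the number of fully reducible words of length 2m over {1,…,d}, and W_{n−k,2k}^{(d)} is the number of words of length 2n whose irreducible string equals any fixed irreducible string of length 2k (this number is the same for all such strings). Here d(d−1)^{2k−1} is the number of irreducible strings of length 2k over {1,…,d}. -/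
open scoped Classical

/-- One step of the stack-based reduction: push the letter if the stack is empty or
its top differs from the current letter, otherwise pop the top. -/
def redStep {d : ℕ} (s : List (Fin d)) (a : Fin d) : List (Fin d) :=
  match s with
  | [] => [a]
  | b :: rest => if a = b then rest else a :: b :: rest

/-- The irreducible string of a word: the final stack content read from bottom to top. -/
def irrOf {d N : ℕ} (w : Fin N → Fin d) : List (Fin d) :=
  ((List.ofFn w).foldl redStep []).reverse

/-- A word is fully reducible if its irreducible string is empty. -/
def FullyReducible {d N : ℕ} (w : Fin N → Fin d) : Prop := irrOf w = []

/-- `W d m` is the number of fully reducible words of length `2m` over `{1,…,d}`. -/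
noncomputable def W (d m : ℕ) : ℕ :=
  Nat.card {w : Fin (2 * m) → Fin d // FullyReducible w}

/-- `Wx d N x` is the number of words of length `N` over `{1,…,d}` whose irreducible
string equals `x`. -/
noncomputable def Wx (d N : ℕ) (x : List (Fin d)) : ℕ :=
  Nat.card {w : Fin N → Fin d // irrOf w = x}


/-- Number of words of length `N` with a given irreducible string of length `k`. -/
def cnt (d : ℕ) : ℕ → ℕ → ℕ
  | 0, 0 => 1
  | 0, _ + 1 => 0
  | N + 1, 0 => d * cnt d N 1
  | N + 1, k + 1 => cnt d N k + (d - 1) * cnt d N (k + 2)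

/-- Number of irreducible strings of length `k`. -/
def wt (d : ℕ) : ℕ → ℕ
  | 0 => 1
  | k + 1 => d * (d - 1) ^ k

theorem cnt_big (d : ℕ) : ∀ N k, N < k → cnt d N k = 0 := by
  intro N
  induction N with
  | zero => intro k hk; cases k with
    | zero => omega
    | succ k => rfl
  | succ N ih => intro k hk; cases k with
    | zero => omega
    | succ k => simp [cnt, ih k (by omega), ih (k+2) (by omega)]

theorem cnt_odd (d : ℕ) : ∀ N k, (N + k) % 2 = 1 → cnt d N k = 0 := by
  intro N
  induction N with
  | zero => intro k hk; cases k with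
    | zero => omega
    | succ k => rfl
  | succ N ih => intro k hk; cases k with
    | zero => simp [cnt, ih 1 (by omega)]
    | succ k => simp [cnt, ih k (by omega), ih (k+2) (by omega)]

theorem sum_step (d N M K : ℕ) :
    ∑ k ∈ Finset.range (K + 1), wt d k * cnt d (N + 1) k * cnt d M k =
      ∑ k ∈ Finset.range (K + 1), wt d (k + 1) * cnt d N (k + 1) * cnt d M k +
      ∑ k ∈ Finset.range K, wt d (k + 1) * cnt d N k * cnt d M (k + 1) := by
  rw [Finset.sum_range_succ', Finset.sum_range_succ', add_right_comm, ← Finset.sum_add_distrib]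
  congr 1
  · apply Finset.sum_congr rfl
    intro k _
    simp only [cnt, wt]
    ring
  · simp [cnt, wt]

theorem sum_swap (d N M K : ℕ) (h : N < K + 1) (h' : M < K + 1) :
    ∑ k ∈ Finset.range (K + 1), wt d k * cnt d (N + 1) k * cnt d M k =
      ∑ k ∈ Finset.range (K + 1), wt d k * cnt d N k * cnt d (M + 1) k := by
  have e : ∀ k, wt d k * cnt d N k * cnt d (M + 1) k = wt d k * cnt d (M + 1) k * cnt d N k :=
    fun k => by ring
  simp only [e]
  rw [sum_step, sum_step, Finset.sum_range_succ, Finset.sum_range_succ, cnt_big d N _ h,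
    cnt_big d M _ h']
  simp only [mul_zero, zero_mul, add_zero]
  rw [add_comm]
  congr 1 <;> exact Finset.sum_congr rfl fun k _ => by ring

theorem cnt_add (d K : ℕ) : ∀ N M, N + M < K + 1 →
    cnt d (N + M) 0 = ∑ k ∈ Finset.range (K + 1), wt d k * cnt d N k * cnt d M k := by
  intro N
  induction N with
  | zero =>
    intro M _
    rw [Finset.sum_range_succ']
    simp [cnt, wt]
  | succ N ih =>
    intro M h
    rw [sum_swap d N M K (by omega) (by omega), ← ih (M + 1) (by omega)]
    congr 1
    omega

theorem redStep_irr {d : ℕ} (s : List (Fin d)) (a : Fin d) (h : s.IsChain (· ≠ ·)) :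
    (redStep s a).IsChain (· ≠ ·) := by
  cases s with
  | nil => simp [redStep]
  | cons b r =>
    simp only [redStep]
    split_ifs with hab
    · exact h.tail
    · exact List.isChain_cons_cons.2 ⟨hab, h⟩

theorem redStep_invol {d : ℕ} (s : List (Fin d)) (a : Fin d) (h : s.IsChain (· ≠ ·)) :
    redStep (redStep s a) a = s := by
  cases s with
  | nil => simp [redStep]
  | cons b r =>
    by_cases hab : a = b
    · subst hab
      cases r with
      | nil => simp [redStep]
      | cons c r =>
        have := (List.isChain_cons_cons.1 h).1
        simp [redStep, this]
    · simp [redStep, hab]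

theorem foldl_irr {d : ℕ} (w : List (Fin d)) : ∀ s : List (Fin d), s.IsChain (· ≠ ·) →
    (w.foldl redStep s).IsChain (· ≠ ·) := by
  induction w with
  | nil => intro s h; exact h
  | cons a w ih => intro s h; exact ih _ (redStep_irr s a h)

noncomputable def stk (d N : ℕ) (s : List (Fin d)) : ℕ :=
  Nat.card {w : Fin N → Fin d // (List.ofFn w).foldl redStep [] = s}

theorem stk_succ (d N : ℕ) (s : List (Fin d)) (h : s.IsChain (· ≠ ·)) :
    stk d (N + 1) s = ∑ a, stk d N (redStep s a) := by
  unfold stk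
  rw [← Nat.card_sigma]
  have key : ∀ (u : Fin N → Fin d) (a : Fin d),
      (List.ofFn (Fin.snoc u a : Fin (N+1) → Fin d)).foldl redStep [] = s ↔
      (List.ofFn u).foldl redStep [] = redStep s a := by
    intro u a
    have : List.ofFn (Fin.snoc u a : Fin (N+1) → Fin d) = List.ofFn u ++ [a] := by
      rw [List.ofFn_succ']
      simp
    rw [this, List.foldl_append]
    simp only [List.foldl_cons, List.foldl_nil]
    have hc := foldl_irr (List.ofFn u) [] (by simp)
    constructor
    · intro e; rw [← e, redStep_invol _ _ hc]
    · intro e; rw [e, redStep_invol _ _ h]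
  refine Nat.card_congr ⟨fun w => ⟨w.1 (Fin.last N), Fin.init w.1, ?_⟩,
    fun p => ⟨Fin.snoc p.2.1 p.1, (key _ _).2 p.2.2⟩, ?_, ?_⟩
  · rw [← key]
    have := w.2
    rwa [← Fin.snoc_init_self w.1] at this
  · intro w
    apply Subtype.ext
    exact Fin.snoc_init_self w.1
  · rintro ⟨a, u, hu⟩
    have h1 : (Fin.snoc u a : Fin (N+1) → Fin d) (Fin.last N) = a := Fin.snoc_last _ _
    have h2 : Fin.init (Fin.snoc u a : Fin (N+1) → Fin d) = u := Fin.init_snoc _ _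
    refine Sigma.subtype_ext ?_ ?_
    · exact h1
    · exact h2

theorem stk_eq (d : ℕ) : ∀ (N : ℕ) (s : List (Fin d)), s.IsChain (· ≠ ·) →
    stk d N s = cnt d N s.length := by
  intro N
  induction N with
  | zero =>
    intro s _
    cases s with
    | nil => simp [stk, cnt]
    | cons a r => simp [stk, cnt]
  | succ N ih =>
    intro s h
    rw [stk_succ d N s h, Finset.sum_congr rfl fun a _ => ih _ (redStep_irr s a h)]
    cases s with
    | nil => simp [redStep, cnt]
    | cons b r =>
      rw [← Finset.add_sum_erase _ _ (Finset.mem_univ b)]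
      rw [Finset.sum_congr (g := fun _ => cnt d N (r.length + 2)) rfl]
      · simp [redStep, cnt, Finset.card_erase_of_mem]
      · intro a ha
        have : a ≠ b := (Finset.mem_erase.1 ha).1
        simp [redStep, this]

theorem Wx_eq (d N : ℕ) (x : List (Fin d)) (h : x.IsChain (· ≠ ·)) :
    Wx d N x = cnt d N x.length := by
  have h' : x.reverse.IsChain (· ≠ ·) := by
    rw [List.isChain_reverse]
    exact h.imp fun _ _ e => e.symm
  rw [← List.length_reverse, ← stk_eq d N _ h']
  unfold Wx stk irrOf
  simp only [List.reverse_eq_iff]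

theorem W_eq (d m : ℕ) : W d m = cnt d (2 * m) 0 := Wx_eq d (2 * m) [] (by simp)

theorem sum_even (f : ℕ → ℕ) (hf : ∀ k, k % 2 = 1 → f k = 0) (n : ℕ) :
    ∑ k ∈ Finset.range (2 * n + 1), f k = f 0 + ∑ k ∈ Finset.Icc 1 n, f (2 * k) := by
  induction n with
  | zero => simp
  | succ n ih =>
    rw [Finset.sum_Icc_succ_top (by omega), show 2 * (n + 1) + 1 = 2 * n + 1 + 1 + 1 by ring,
      Finset.sum_range_succ, Finset.sum_range_succ, ih, hf (2 * n + 1) (by omega),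
      show 2 * (n + 1) = 2 * n + 1 + 1 by ring]
    ring

/-- for every `d ≥ 2` and `n ≥ 1`,
`W_{2n}^{(d)} = (W_n^{(d)})² + Σ_{k=1}^{n} d(d−1)^{2k−1} · (W_{n−k, 2k}^{(d)})²`,
where `W_{n−k,2k}^{(d)}` is the number of words of length `2n` whose irreducible string
equals any fixed irreducible string of length `2k` (quantified here over all choices
of such strings `x k`). -/
theorem pf_schmidt_decomposition (d : ℕ) (hd : 2 ≤ d) (n : ℕ) (hn : 1 ≤ n)
    (x : ℕ → List (Fin d))
    (hx : ∀ k, 1 ≤ k → k ≤ n → (x k).length = 2 * k ∧ (x k).Chain' (· ≠ ·)) :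
    W d (2 * n) = (W d n) ^ 2 +
      ∑ k ∈ Finset.Icc 1 n, d * (d - 1) ^ (2 * k - 1) * (Wx d (2 * n) (x k)) ^ 2 := by
  have h1 := cnt_add d (2 * (2 * n)) (2 * n) (2 * n) (by omega)
  rw [sum_even _ (fun k hk => by rw [cnt_odd d (2 * n) k (by omega)]; simp)] at h1
  rw [W_eq, W_eq, show 2 * (2 * n) = 2 * n + 2 * n by ring, h1]
  have hs : Finset.Icc 1 n ⊆ Finset.Icc 1 (2 * n) := Finset.Icc_subset_Icc le_rfl (by omega)
  rw [← Finset.sum_subset hs]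
  · refine congrArg₂ (· + ·) ?_ ?_
    · simp only [wt]; ring
    · apply Finset.sum_congr rfl
      intro k hk
      rw [Finset.mem_Icc] at hk
      obtain ⟨hl, hc⟩ := hx k hk.1 hk.2
      rw [Wx_eq d _ _ hc, hl]
      obtain ⟨j, rfl⟩ : ∃ j, k = j + 1 := ⟨k - 1, by omega⟩
      rw [show 2 * (j + 1) - 1 = 2 * j + 1 by omega, show 2 * (j + 1) = 2 * j + 1 + 1 by ring]
      simp only [wt]
      ring
  · intro k _ hk
    rw [Finset.mem_Icc] at *
    rw [cnt_big d (2 * n) (2 * k) (by omega)]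
    simp
end
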